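/- arXiv:2210.05212 — 2 statements merged into one kernel-verified Lean document; each statement's English description precedes it below -/
import Mathlib

section
/- There exist a constant δ > 0 (independent of the width) and a threshold K ∈ ℕ such that for every k ≥ K, if the weights a_1, …, a_k are i.i.d. Gaussian N(0, 2/k) (He normal initialization) and the biases b_1, …, b_k are i.i.d. Uniform[0,1] independent of the weights, then the probability that the RNN step map f_{a,b} is Li-Yorke chaotic is at least δ. -/
open MeasureTheory ProbabilityTheory Filter Set
open scoped NNReal ENNReal

/-- Clip a real number to the interval `[0,1]`. -/
noncomputable def clip (y : ℝ) : ℝ := min (max y 0) 1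

/-- The RNN step map `f_{a,b}(x) = clip (∑ i, a i * ReLU (x - b i))`. -/
noncomputable def rnnStep {k : ℕ} (a b : Fin k → ℝ) (x : ℝ) : ℝ :=
  clip (∑ i, a i * max (x - b i) 0)

/-- `f` is Li-Yorke chaotic on `[0,1]`: there is an uncountable scrambled set. -/
def LiYorkeChaotic (f : ℝ → ℝ) : Prop :=
  ∃ S : Set ℝ, S ⊆ Set.Icc 0 1 ∧ ¬ S.Countable ∧
    ∀ x ∈ S, ∀ y ∈ S, x ≠ y →
      Filter.liminf (fun n => |f^[n] x - f^[n] y|) Filter.atTop = 0 ∧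
      0 < Filter.limsup (fun n => |f^[n] x - f^[n] y|) Filter.atTop

/-- The joint law of `k` i.i.d. `N(0, v)` weights and `k` i.i.d. `Uniform[0,1]`
biases, independent of each other. -/
noncomputable def rnnMeasure (k : ℕ) (v : ℝ≥0) :
    Measure ((Fin k → ℝ) × (Fin k → ℝ)) :=
  (Measure.pi fun _ => gaussianReal 0 v).prod
    (Measure.pi fun _ => volume.restrict (Set.Icc (0:ℝ) 1))

/-- If each closed `E k ⊆ Q` is mapped over the compact set `Q` by `f^[m k]`, then some orbit starting
in `Q` visits all the `E k` in turn, with waiting times `m k`. -/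
lemma exists_forall_iterate_mem {f : ℝ → ℝ} (hf : Continuous f) {Q : Set ℝ} (hQ : IsCompact Q)
    (hne : Q.Nonempty) {E : ℕ → Set ℝ} (hE : ∀ k, IsClosed (E k)) (hEQ : ∀ k, E k ⊆ Q)
    {m : ℕ → ℕ} (hcov : ∀ k, Q ⊆ f^[m k] '' E k) :
    ∃ x ∈ Q, ∀ k, f^[∑ j ∈ Finset.range k, m j] x ∈ E k := by
  have key : ∀ n, ∀ y ∈ Q, ∃ x ∈ Q, (∀ k < n, f^[∑ j ∈ Finset.range k, m j] x ∈ E k) ∧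
      f^[∑ j ∈ Finset.range n, m j] x = y := by
    intro n
    induction n with
    | zero => exact fun y hy => ⟨y, hy, by simp, by simp⟩
    | succ n ih =>
      intro y hy
      obtain ⟨e, he, rfl⟩ := hcov n hy
      obtain ⟨x, hx, hxk, rfl⟩ := ih e (hEQ n he)
      refine ⟨x, hx, fun k hk => ?_, ?_⟩
      · rcases Nat.lt_succ_iff_lt_or_eq.1 hk with h | rfl
        · exact hxk k h
        · exact he
      · rw [Finset.sum_range_succ, add_comm, Function.iterate_add_apply]
  let C : ℕ → Set ℝ := fun n =>
    Q ∩ ⋂ k, ⋂ (_ : k < n), f^[∑ j ∈ Finset.range k, m j] ⁻¹' E k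
  have hC : ∀ n, IsClosed (C n) := fun n => hQ.isClosed.inter <| isClosed_iInter fun k =>
    isClosed_iInter fun _ => (hE k).preimage (hf.iterate _)
  obtain ⟨x, hx⟩ := IsCompact.nonempty_iInter_of_sequence_nonempty_isCompact_isClosed C
    (fun n x hx => by
      simp only [C, mem_inter_iff, mem_iInter, mem_preimage] at hx ⊢
      exact ⟨hx.1, fun k hk => hx.2 k (hk.trans n.lt_succ_self)⟩)
    (fun n => by
      obtain ⟨y, hy⟩ := hne
      obtain ⟨x, hx, hxk, -⟩ := key n y hy
      exact ⟨x, by simpa [C] using ⟨hx, hxk⟩⟩)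
    (hQ.of_isClosed_subset (hC 0) inter_subset_left) hC
  simp only [C, mem_inter_iff, mem_iInter, mem_preimage] at hx
  exact ⟨x, (hx 0).1, fun k => (hx (k + 1)).2 k k.lt_succ_self⟩

/-- A continuous map with `f 0 = 0` and `f (1/2) = 1` has a fixed point `z < 1/2` which is the limit
of a decreasing backward orbit of `1/2`. -/
lemma exists_fixedPoint_and_backward_orbit {f : ℝ → ℝ} (hf : Continuous f) (h0 : f 0 = 0)
    (h1 : f (1 / 2) = 1) :
    ∃ (z : ℝ) (u : ℕ → ℝ), 0 ≤ z ∧ f z = z ∧ StrictAnti u ∧ u 0 = 1 / 2 ∧ (∀ n, z < u n) ∧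
      (∀ n, f (u (n + 1)) = u n) ∧ Tendsto u atTop (nhds z) := by
  obtain ⟨z, ⟨⟨hz0, hz1⟩, hfz⟩, hmax⟩ :=
    (isCompact_Icc.inter_right (isClosed_eq hf continuous_id) :
      IsCompact (Icc (0 : ℝ) (1 / 2) ∩ {x | f x = id x})).exists_isGreatest
      ⟨0, by norm_num, by simpa using h0⟩
  replace hfz : f z = z := hfz
  have hfix : ∀ x, z ≤ x → x ≤ 1 / 2 → f x = x → x = z := fun x hzx hx hfx =>
    le_antisymm (hmax ⟨⟨hz0.trans hzx, hx⟩, hfx⟩) hzx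
  have hz1' : z < 1 / 2 := lt_of_le_of_ne hz1 fun h => by
    rw [h, h1] at hfz
    norm_num at hfz
  have hlt : ∀ x, z < x → x ≤ 1 / 2 → x < f x := by
    intro x hzx hx
    by_contra! hfx
    obtain ⟨y, hy, hfy⟩ := intermediate_value_Icc hx (hf.sub continuous_id).continuousOn
      (show (0 : ℝ) ∈ Icc _ _ by constructor <;> simp <;> linarith)
    have := hfix y (hzx.le.trans hy.1) hy.2 (by simpa [sub_eq_zero] using hfy)
    linarith [hy.1]
  have hstep : ∀ w : Ioc z (1 / 2), ∃ w' : Ioc z (1 / 2), w' < w ∧ f w' = w := by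
    rintro ⟨w, hw⟩
    obtain ⟨w', hw', h⟩ := intermediate_value_Ioo hw.1.le hf.continuousOn
      (show w ∈ Ioo (f z) (f w) from ⟨by rw [hfz]; exact hw.1, hlt w hw.1 hw.2⟩)
    exact ⟨⟨w', hw'.1, hw'.2.le.trans hw.2⟩, hw'.2, h⟩
  choose g hg hfg using hstep
  let v : ℕ → Ioc z (1 / 2) := fun n => g^[n] ⟨1 / 2, hz1', le_rfl⟩
  have hv : ∀ n, v (n + 1) = g (v n) := fun n => Function.iterate_succ_apply' _ _ _
  have hanti : StrictAnti fun n => (v n : ℝ) := strictAnti_nat_of_succ_lt fun n => by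
    rw [hv]; exact hg _
  have hfv : ∀ n, f (v (n + 1)) = v n := fun n => by rw [hv, hfg]
  refine ⟨z, fun n => v n, hz0, hfz, hanti, rfl, fun n => (v n).2.1, hfv, ?_⟩
  have hlim := tendsto_atTop_ciInf hanti.antitone
    ⟨z, by rintro _ ⟨n, rfl⟩; exact (v n).2.1.le⟩
  set L := ⨅ n, (v n : ℝ)
  have hzL : z ≤ L := ge_of_tendsto' hlim fun n => (v n).2.1.le
  have hL : L ≤ 1 / 2 := le_of_tendsto' hlim fun n => (v n).2.2
  have hfL : f L = L := tendsto_nhds_unique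
    ((hf.tendsto L).comp (hlim.comp (tendsto_add_atTop_nat 1)))
    (hlim.congr fun n => (hfv n).symm)
  rwa [hfix L hzL hL hfL] at hlim

/-- An uncountable family of orbits that are pairwise infinitely often close and infinitely often
separated gives a Li-Yorke scrambled set. -/
lemma LiYorkeChaotic.of_frequently {f : ℝ → ℝ} (hI : ∀ x ∈ Icc (0 : ℝ) 1, f x ∈ Icc (0 : ℝ) 1)
    {ι : Type*} [Uncountable ι] (X : ι → ℝ) (hX : ∀ i, X i ∈ Icc (0 : ℝ) 1) {d : ℝ} (hd : 0 < d)
    (hclose : ∀ i j, ∀ ε > 0, ∃ᶠ n in atTop, |f^[n] (X i) - f^[n] (X j)| ≤ ε)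
    (hsep : ∀ i j, i ≠ j → ∃ᶠ n in atTop, d ≤ |f^[n] (X i) - f^[n] (X j)|) :
    LiYorkeChaotic f := by
  have hiter : ∀ i n, f^[n] (X i) ∈ Icc (0 : ℝ) 1 := fun i n => by
    have : MapsTo f (Icc 0 1) (Icc 0 1) := hI
    exact this.iterate n (hX i)
  have hle : ∀ i j n, |f^[n] (X i) - f^[n] (X j)| ≤ 1 := fun i j n => by
    have h₁ := hiter i n
    have h₂ := hiter j n
    rw [abs_le]
    constructor <;> linarith [h₁.1, h₁.2, h₂.1, h₂.2]
  have hinj : Function.Injective X := by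
    intro i j hij
    by_contra hne
    obtain ⟨n, hn⟩ := (hsep i j hne).exists
    rw [hij, sub_self, abs_zero] at hn
    exact absurd hn hd.not_ge
  refine ⟨range X, by rintro _ ⟨i, rfl⟩; exact hX i, ?_, ?_⟩
  · intro h
    have : Countable (range X) := h
    exact not_countable (α := ι) ((Equiv.ofInjective X hinj).injective.countable)
  · rintro _ ⟨i, rfl⟩ _ ⟨j, rfl⟩ hne
    have hb : IsBoundedUnder (· ≤ ·) atTop fun n => |f^[n] (X i) - f^[n] (X j)| :=
      isBoundedUnder_of ⟨1, hle i j⟩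
    have hb' : IsBoundedUnder (· ≥ ·) atTop fun n => |f^[n] (X i) - f^[n] (X j)| :=
      isBoundedUnder_of ⟨0, fun n => abs_nonneg _⟩
    refine ⟨le_antisymm (le_of_forall_pos_le_add fun ε hε => ?_) ?_, hd.trans_le ?_⟩
    · rw [zero_add]
      exact liminf_le_of_frequently_le (hclose i j ε hε) hb'
    · exact le_liminf_of_le hb.isCoboundedUnder_ge (Eventually.of_forall fun n => abs_nonneg _)
    · exact le_limsup_of_frequently_le (hsep i j fun h => hne (congrArg X h)) hb

/-- A continuous self-map of `[0,1]` sending `0, 1/2, 1` to `0, 1, 0` is Li-Yorke chaotic. -/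
theorem LiYorkeChaotic.of_continuous {f : ℝ → ℝ} (hf : Continuous f)
    (hI : ∀ x ∈ Icc (0 : ℝ) 1, f x ∈ Icc (0 : ℝ) 1) (h0 : f 0 = 0) (h1 : f (1 / 2) = 1)
    (h2 : f 1 = 0) : LiYorkeChaotic f := by
  obtain ⟨z, u, hz0, hfz, hanti, hu0, hzu, hfu, hlim⟩ :=
    exists_fixedPoint_and_backward_orbit hf h0 h1
  have hu : ∀ n, u n ≤ 1 / 2 := fun n => hu0 ▸ hanti.antitone n.zero_le
  have hu1 : u 1 < 1 / 2 := hu0 ▸ hanti Nat.zero_lt_one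
  have hcov : ∀ n, Icc z 1 ⊆ f^[n + 1] '' Icc z (u n) := by
    intro n
    induction n with
    | zero =>
      have := intermediate_value_Icc (hzu 0).le hf.continuousOn
      rwa [hfz, hu0, h1, ← hu0] at this
    | succ n ih =>
      intro y hy
      obtain ⟨w, hw, rfl⟩ := ih hy
      obtain ⟨v, hv, rfl⟩ := intermediate_value_Icc (hzu (n + 1)).le hf.continuousOn
        (by rwa [hfz, hfu] : w ∈ Icc (f z) (f (u (n + 1))))
      exact ⟨v, hv, Function.iterate_succ_apply _ _ _⟩
  let A : Bool → Set ℝ := fun c => bif c then Icc z (u 1) else Icc (1 / 2) 1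
  have hAc : ∀ c, IsClosed (A c) := by rintro (_ | _) <;> exact isClosed_Icc
  have hAQ : ∀ c, A c ⊆ Icc z 1 := by
    rintro (_ | _)
    · exact Icc_subset_Icc_left ((hzu 0).le.trans (hu 0))
    · exact Icc_subset_Icc_right (by linarith)
  have hAcov : ∀ c, Icc z 1 ⊆ f^[2] '' A c := by
    rintro (_ | _)
    · have hB : Icc z 1 ⊆ f '' Icc (1 / 2) 1 := by
        have := intermediate_value_Icc' (by norm_num : (1 / 2 : ℝ) ≤ 1) hf.continuousOn
        rw [h1, h2] at this
        exact (Icc_subset_Icc_left hz0).trans this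
      intro y hy
      obtain ⟨w, hw, rfl⟩ := hB hy
      obtain ⟨v, hv, rfl⟩ := hB (hAQ false hw)
      exact ⟨v, hv, rfl⟩
    · exact hcov 1
  let E : (ℕ → Bool) → ℕ → Set ℝ := fun θ k => A (θ k.unpair.1) ∩ f^[2] ⁻¹' Icc z (u k)
  have hEcov : ∀ θ k, Icc z 1 ⊆ f^[k + 3] '' E θ k := by
    intro θ k y hy
    obtain ⟨w, hw, rfl⟩ := hcov k hy
    obtain ⟨v, hv, rfl⟩ := hAcov (θ k.unpair.1) ⟨hw.1, hw.2.trans ((hu k).trans (by norm_num))⟩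
    exact ⟨v, ⟨hv, hw⟩, Function.iterate_add_apply f (k + 1) 2 v⟩
  have hex : ∀ θ, ∃ x ∈ Icc z 1, ∀ k, f^[∑ j ∈ Finset.range k, (j + 3)] x ∈ E θ k := fun θ =>
    exists_forall_iterate_mem hf isCompact_Icc ⟨1, by linarith [hzu 0, hu 0], le_rfl⟩
      (fun k => (hAc _).inter (isClosed_Icc.preimage (hf.iterate 2)))
      (fun k => inter_subset_left.trans (hAQ _)) (hEcov θ)
  choose X hXQ hX using hex
  have : Uncountable (ℕ → Bool) := by
    rw [← Cardinal.aleph0_lt_mk_iff]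
    simpa using Cardinal.cantor Cardinal.aleph0
  set t : ℕ → ℕ := fun k => ∑ j ∈ Finset.range k, (j + 3)
  have ht : ∀ k, k ≤ t k := fun k =>
    calc k = ∑ j ∈ Finset.range k, 1 := by simp
      _ ≤ t k := Finset.sum_le_sum fun j _ => by omega
  have hsep : ∀ c c', c ≠ c' → ∀ x ∈ A c, ∀ y ∈ A c', 1 / 2 - u 1 ≤ |x - y| := by
    rintro (_ | _) (_ | _) h x hx y hy
    · exact absurd rfl h
    · exact (by linarith [hx.1, hy.2] : _ ≤ x - y).trans (le_abs_self _)
    · rw [abs_sub_comm]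
      exact (by linarith [hx.2, hy.1] : _ ≤ y - x).trans (le_abs_self _)
    · exact absurd rfl h
  refine LiYorkeChaotic.of_frequently hI X (fun θ => Icc_subset_Icc_left hz0 (hXQ θ))
    (sub_pos.2 hu1) (fun θ θ' ε hε => ?_) (fun θ θ' hne => ?_)
  · rw [frequently_atTop]
    intro N
    obtain ⟨k, hk, hNk⟩ := ((hlim.eventually (gt_mem_nhds (lt_add_of_pos_right z hε))).and
      (eventually_ge_atTop N)).exists
    refine ⟨2 + t k, by linarith [ht k], ?_⟩
    rw [Function.iterate_add_apply, Function.iterate_add_apply, abs_le]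
    have h₁ := (hX θ k).2
    have h₂ := (hX θ' k).2
    constructor <;> linarith [h₁.1, h₁.2, h₂.1, h₂.2]
  · rw [frequently_atTop]
    intro N
    obtain ⟨i, hi⟩ := Function.ne_iff.1 hne
    refine ⟨t (Nat.pair i N), (Nat.right_le_pair i N).trans (ht _), ?_⟩
    have h₁ := (hX θ (Nat.pair i N)).1
    have h₂ := (hX θ' (Nat.pair i N)).1
    rw [Nat.unpair_pair] at h₁ h₂
    exact hsep _ _ hi _ h₁ _ h₂

/-- A linear combination of i.i.d. centered Gaussians is Gaussian. -/
lemma map_sum_mul_pi_gaussianReal {ι : Type*} [Fintype ι] (v : ℝ≥0) (c : ι → ℝ) :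
    (Measure.pi fun _ : ι => gaussianReal 0 v).map (fun a => ∑ i, a i * c i) =
      gaussianReal 0 (v * ∑ i, c i ^ 2).toNNReal := by
  have hind : iIndepFun (fun i (a : ι → ℝ) => a i * c i)
      (Measure.pi fun _ : ι => gaussianReal 0 v) :=
    iIndepFun_pi (X := fun i x => x * c i) fun i => by fun_prop
  have hlaw : ∀ i, HasLaw (fun a : ι → ℝ => a i * c i)
      (gaussianReal (c i * 0) (.mk (c i ^ 2) (sq_nonneg _) * v))
      (Measure.pi fun _ : ι => gaussianReal 0 v) := fun i =>
    gaussianReal_mul_const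
      ⟨(measurable_pi_apply i).aemeasurable,
        (measurePreserving_eval (fun _ : ι => gaussianReal 0 v) i).map_eq⟩ (c i)
  have hsum := iIndepFun.hasGaussianLaw_fun_sum (fun i => (hlaw i).hasGaussianLaw) hind
  have hmemLp : ∀ i, MemLp (fun x => x * c i) 2 (gaussianReal 0 v) := fun i =>
    ((memLp_id_gaussianReal 2).mul_const (c i) :)
  have hvar : ∀ i, Var[fun x => x * c i; gaussianReal 0 v] = v * c i ^ 2 := fun i => by
    rw [variance_mul_const, variance_fun_id_gaussianReal]
  have hmean : ∫ a, ∑ i, a i * c i ∂(Measure.pi fun _ : ι => gaussianReal 0 v) = 0 := by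
    rw [integral_finsetSum _ fun i _ => ((hlaw i).hasGaussianLaw).integrable]
    refine Finset.sum_eq_zero fun i _ => ?_
    rw [(hlaw i).integral_eq, integral_id_gaussianReal, mul_zero]
  have hv := variance_sum_pi hmemLp
  simp only [hvar, ← Finset.mul_sum] at hv
  rw [hsum.map_eq_gaussianReal, hmean, ← hv]
  congr
  ext a
  simp

/-- The Gaussian tails are bounded below, uniformly over variances bounded below. -/
lemma exists_le_gaussianReal_Ici {s : ℝ} (hs : 0 < s) (r : ℝ) (hr : 0 ≤ r) :
    ∃ δ > 0, ∀ w : ℝ, s ≤ w → δ ≤ (gaussianReal 0 w.toNNReal).real (Ici r) := by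
  have hne : gaussianReal 0 1 (Ici (r / √s)) ≠ 0 := fun h => by
    have := gaussianReal_absolutelyContinuous' 0 one_ne_zero h
    simp at this
  refine ⟨(gaussianReal 0 1).real (Ici (r / √s)),
    ENNReal.toReal_pos hne (measure_ne_top _ _), fun w hw => ?_⟩
  have hmap := gaussianReal_map_const_mul (μ := 0) (v := 1) (√w)
  have hvar : NNReal.mk (√w ^ 2) (sq_nonneg _) * 1 = w.toNNReal := by
    rw [mul_one]
    ext
    simp [Real.sq_sqrt (hs.le.trans hw), hs.le.trans hw]
  rw [hvar, mul_zero] at hmap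
  rw [← hmap, map_measureReal_apply (by fun_prop) measurableSet_Ici]
  refine measureReal_mono fun x hx => ?_
  have hx' : r / √s ≤ x := hx
  rw [div_le_iff₀ (Real.sqrt_pos.2 hs)] at hx'
  have hx0 : 0 ≤ x := le_trans (by positivity) (show r / √s ≤ x from hx)
  calc r ≤ x * √s := hx'
    _ ≤ x * √w := by gcongr
    _ = √w * x := mul_comm _ _

lemma gaussianReal_Ici_le {M : ℝ} (hM : 0 < M) (w : ℝ≥0) :
    (gaussianReal 0 w).real (Ici M) ≤ w / M ^ 2 := by
  have h := meas_ge_le_variance_div_sq (memLp_id_gaussianReal (μ := 0) (v := w) 2) hM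
  rw [variance_id_gaussianReal] at h
  simp only [id_eq, integral_id_gaussianReal, sub_zero] at h
  refine ENNReal.toReal_le_of_le_ofReal (by positivity) ((measure_mono fun x hx => ?_).trans h)
  exact (show M ≤ x from hx).trans (le_abs_self x)

/-- Two Gaussian linear forms are jointly `≥ 1` and `≤ 0` with probability bounded below, when the
second one has an independent component `e` of variance bounded below. -/
lemma exists_le_pi_gaussianReal {s : ℝ} (hs : 0 < s) (C : ℝ) :
    ∃ δ > 0, ∀ {ι : Type} [Fintype ι] (v : ℝ≥0) (c d e : ι → ℝ),
      (∀ i, e i = 0 ∨ c i = 0 ∧ d i = 0) → s ≤ v * ∑ i, c i ^ 2 → v * ∑ i, d i ^ 2 ≤ C →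
      s ≤ v * ∑ i, e i ^ 2 →
      δ ≤ (Measure.pi fun _ : ι => gaussianReal 0 v).real
        {a | 1 ≤ ∑ i, a i * c i ∧ ∑ i, a i * (d i + e i) ≤ 0} := by
  classical
  obtain ⟨δ₁, hδ₁, h₁⟩ := exists_le_gaussianReal_Ici hs 1 zero_le_one
  obtain ⟨M, hM, hCM⟩ : ∃ M > 0, C / M ^ 2 ≤ δ₁ / 2 := by
    have : Tendsto (fun M : ℝ => C / M ^ 2) atTop (nhds 0) :=
      (tendsto_pow_atTop two_ne_zero).const_div_atTop C
    obtain ⟨M, hM, hM0⟩ := ((this.eventually_le_const (half_pos hδ₁)).and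
      (eventually_gt_atTop 0)).exists
    exact ⟨M, hM0, hM⟩
  obtain ⟨δ₂, hδ₂, h₂⟩ := exists_le_gaussianReal_Ici hs M hM.le
  refine ⟨δ₁ / 2 * δ₂, by positivity, fun {ι} _ v c d e hdisj hc hd he => ?_⟩
  set μ := Measure.pi fun _ : ι => gaussianReal 0 v
  have hlin : ∀ (c : ι → ℝ) (r : ℝ), μ.real {a | r ≤ ∑ i, a i * c i} =
      (gaussianReal 0 (v * ∑ i, c i ^ 2).toNNReal).real (Ici r) := fun c r => by
    rw [← map_sum_mul_pi_gaussianReal, map_measureReal_apply (by fun_prop) measurableSet_Ici]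
    rfl
  have hU : δ₁ ≤ μ.real {a | 1 ≤ ∑ i, a i * c i} := (h₁ _ hc).trans_eq (hlin c 1).symm
  have hV : μ.real {a | M ≤ ∑ i, a i * d i} ≤ δ₁ / 2 := by
    rw [hlin]
    refine (gaussianReal_Ici_le hM _).trans (le_trans ?_ hCM)
    rw [Real.coe_toNNReal _ (by positivity)]
    gcongr
  have hW : δ₂ ≤ μ.real {a | M ≤ ∑ i, a i * -e i} := by
    rw [hlin]
    simpa using h₂ _ he
  have hUV : δ₁ / 2 ≤ μ.real {a | 1 ≤ ∑ i, a i * c i ∧ ∑ i, a i * d i < M} := by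
    have hsub : {a : ι → ℝ | 1 ≤ ∑ i, a i * c i} ⊆
        {a | 1 ≤ ∑ i, a i * c i ∧ ∑ i, a i * d i < M} ∪ {a | M ≤ ∑ i, a i * d i} := by
      intro a ha
      rcases lt_or_ge (∑ i, a i * d i) M with h | h
      · exact Or.inl ⟨ha, h⟩
      · exact Or.inr h
    have := (measureReal_mono hsub (μ := μ)).trans (measureReal_union_le _ _)
    linarith
  let T : Finset ι := Finset.univ.filter fun i => e i = 0
  have hind : IndepFun (fun a : ι → ℝ => fun i : T => a i)
      (fun a : ι → ℝ => fun i : (Tᶜ : Finset ι) => a i) μ :=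
    (iIndepFun_pi (X := fun _ : ι => (id : ℝ → ℝ)) fun _ => aemeasurable_id).indepFun_finset
      T Tᶜ disjoint_compl_right fun i => measurable_pi_apply i
  have hsumT : ∀ (g : ι → ℝ), (∀ i, e i ≠ 0 → g i = 0) → ∀ a : ι → ℝ,
      ∑ i : T, a i * g i = ∑ i, a i * g i := fun g hg a => by
    rw [Finset.sum_coe_sort T fun i => a i * g i]
    refine Finset.sum_subset (Finset.subset_univ _) fun i _ hi => ?_
    rw [hg i (by simpa [T] using hi), mul_zero]
  have hsumTc : ∀ a : ι → ℝ, ∑ i : (Tᶜ : Finset ι), a i * -e i = ∑ i, a i * -e i := fun a => by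
    rw [Finset.sum_coe_sort Tᶜ fun i => a i * -e i]
    refine Finset.sum_subset (Finset.subset_univ _) fun i _ hi => ?_
    have : e i = 0 := by simpa [T] using hi
    simp [this]
  have hcT := hsumT c fun i hi => ((hdisj i).resolve_left hi).1
  have hdT := hsumT d fun i hi => ((hdisj i).resolve_left hi).2
  have hmul := hind.measure_inter_preimage_eq_mul
    {x : T → ℝ | 1 ≤ ∑ i, x i * c i ∧ ∑ i, x i * d i < M}
    {x : (Tᶜ : Finset ι) → ℝ | M ≤ ∑ i, x i * -e i}
    (by
      rw [ofPred_and]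
      exact (measurableSet_le measurable_const (by fun_prop)).inter
        (measurableSet_lt (by fun_prop) measurable_const))
    (measurableSet_le measurable_const (by fun_prop))
  simp only [preimage_ofPred_eq, hcT, hdT, hsumTc] at hmul
  calc δ₁ / 2 * δ₂ ≤ μ.real {a | 1 ≤ ∑ i, a i * c i ∧ ∑ i, a i * d i < M} *
        μ.real {a | M ≤ ∑ i, a i * -e i} := by gcongr
    _ = μ.real ({a | 1 ≤ ∑ i, a i * c i ∧ ∑ i, a i * d i < M} ∩
        {a | M ≤ ∑ i, a i * -e i}) := by
      simp only [Measure.real, hmul, ENNReal.toReal_mul]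
    _ ≤ _ := measureReal_mono fun a ⟨⟨ha₁, ha₂⟩, ha₃⟩ => by
      simp only [mem_ofPred_eq, mul_neg, Finset.sum_neg_distrib] at ha₃
      refine ⟨ha₁, ?_⟩
      simp only [mul_add, Finset.sum_add_distrib]
      linarith

/-- Empirical sums of a `[0,1]`-valued function are at least half their mean with high
probability. -/
lemma pi_real_sum_lt_le {ι : Type*} [Fintype ι] [Nonempty ι] (ν : Measure ℝ)
    [IsProbabilityMeasure ν] {h : ℝ → ℝ} (hm : Measurable h) (hI : ∀ x, h x ∈ Icc (0 : ℝ) 1)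
    (hpos : 0 < ∫ x, h x ∂ν) :
    (Measure.pi fun _ : ι => ν).real {b | ∑ i, h (b i) < Fintype.card ι * ((∫ x, h x ∂ν) / 2)} ≤
      1 / (Fintype.card ι * (∫ x, h x ∂ν) ^ 2) := by
  set m := ∫ x, h x ∂ν
  have hcard : (0 : ℝ) < Fintype.card ι := by exact_mod_cast Fintype.card_pos
  have hLp : MemLp h 2 ν := MemLp.of_bound hm.aestronglyMeasurable 1 (ae_of_all _ fun x => by
    rw [Real.norm_eq_abs, abs_of_nonneg (hI x).1]
    exact (hI x).2)
  have hLpi : ∀ i, MemLp (fun b : ι → ℝ => h (b i)) 2 (Measure.pi fun _ : ι => ν) := fun i =>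
    hLp.comp_measurePreserving (measurePreserving_eval (fun _ : ι => ν) i)
  have hvar := variance_sum_pi (μ := fun _ : ι => ν) (X := fun _ => h) fun _ => hLp
  have hvar_le : Var[h; ν] ≤ 1 / 4 := by
    have := variance_le_sq_of_bounded (ae_of_all ν hI) hm.aemeasurable
    norm_num at this ⊢
    exact this
  have hmean : ∫ b, (∑ i, fun b : ι → ℝ => h (b i)) b ∂(Measure.pi fun _ : ι => ν) =
      Fintype.card ι * m := by
    simp only [Finset.sum_apply]
    rw [integral_finsetSum _ fun i _ => (hLpi i).integrable one_le_two]
    have : ∀ i, ∫ b : ι → ℝ, h (b i) ∂(Measure.pi fun _ : ι => ν) = m := fun i =>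
      integral_comp_eval (μ := fun _ : ι => ν) (i := i) hm.aestronglyMeasurable
    simp [this]
  have hcheb := meas_ge_le_variance_div_sq (memLp_finsetSum' Finset.univ fun i _ => hLpi i)
    (by positivity : 0 < Fintype.card ι * (m / 2))
  rw [hvar, hmean] at hcheb
  have hle : (∑ _i : ι, Var[h; ν]) / (Fintype.card ι * (m / 2)) ^ 2 ≤
      1 / (Fintype.card ι * m ^ 2) := by
    rw [Finset.sum_const, Finset.card_univ, nsmul_eq_mul, div_le_div_iff₀ (by positivity)
      (by positivity)]
    nlinarith [mul_le_mul_of_nonneg_left hvar_le (by positivity :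
      (0 : ℝ) ≤ Fintype.card ι * (Fintype.card ι * m ^ 2))]
  refine ENNReal.toReal_le_of_le_ofReal (by positivity) (((measure_mono fun b hb => ?_).trans
    hcheb).trans (ENNReal.ofReal_le_ofReal hle))
  simp only [mem_ofPred_eq, Finset.sum_apply] at hb ⊢
  rw [abs_sub_comm]
  refine le_trans ?_ (le_abs_self _)
  linarith

lemma clip_mem_Icc (y : ℝ) : clip y ∈ Icc (0 : ℝ) 1 :=
  ⟨le_min (le_max_right _ _) zero_le_one, min_le_right _ _⟩

lemma continuous_rnnStep {k : ℕ} (a b : Fin k → ℝ) : Continuous (rnnStep a b) := by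
  unfold rnnStep clip
  fun_prop

/-- The neurons with bias in `[0, 1/2)`, evaluated at `1/2`. -/
noncomputable def earlyAtHalf : ℝ → ℝ := (Ico 0 (1 / 2)).indicator fun t => 1 / 2 - t

/-- The neurons with bias in `[0, 1/2)`, evaluated at `1`. -/
noncomputable def earlyAtOne : ℝ → ℝ := (Ico 0 (1 / 2)).indicator fun t => 1 - t

/-- The neurons with bias in `[1/2, 1)`, evaluated at `1`. -/
noncomputable def lateAtOne : ℝ → ℝ := (Ico (1 / 2) 1).indicator fun t => 1 - t

@[fun_prop]
lemma measurable_earlyAtHalf : Measurable earlyAtHalf :=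
  Measurable.indicator (by fun_prop) measurableSet_Ico

@[fun_prop]
lemma measurable_earlyAtOne : Measurable earlyAtOne :=
  Measurable.indicator (by fun_prop) measurableSet_Ico

@[fun_prop]
lemma measurable_lateAtOne : Measurable lateAtOne :=
  Measurable.indicator (by fun_prop) measurableSet_Ico

lemma indicator_sub_mem_Icc {l r y : ℝ} (hl : 0 ≤ l) (hr : r ≤ y) (hy : y ≤ 1) (t : ℝ) :
    (Ico l r).indicator (fun t => y - t) t ∈ Icc (0 : ℝ) 1 := by
  by_cases ht : t ∈ Ico l r
  · rw [indicator_of_mem ht]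
    constructor <;> linarith [ht.1, ht.2]
  · simp [indicator_of_notMem ht]

lemma earlyAtHalf_mem_Icc (t : ℝ) : earlyAtHalf t ∈ Icc (0 : ℝ) 1 :=
  indicator_sub_mem_Icc le_rfl le_rfl (by norm_num) t

lemma earlyAtOne_mem_Icc (t : ℝ) : earlyAtOne t ∈ Icc (0 : ℝ) 1 :=
  indicator_sub_mem_Icc le_rfl (by norm_num) le_rfl t

lemma lateAtOne_mem_Icc (t : ℝ) : lateAtOne t ∈ Icc (0 : ℝ) 1 :=
  indicator_sub_mem_Icc (by norm_num) le_rfl le_rfl t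

lemma sq_mem_Icc {x : ℝ} (hx : x ∈ Icc (0 : ℝ) 1) : x ^ 2 ∈ Icc (0 : ℝ) 1 :=
  ⟨sq_nonneg x, pow_le_one₀ hx.1 hx.2⟩

lemma lateAtOne_eq_zero_or (t : ℝ) : lateAtOne t = 0 ∨ earlyAtHalf t = 0 ∧ earlyAtOne t = 0 := by
  rcases lt_or_ge t (1 / 2) with h | h
  · exact Or.inl (indicator_of_notMem (fun ht => absurd ht.1 h.not_ge) _)
  · exact Or.inr ⟨indicator_of_notMem (fun ht => absurd ht.2 h.not_gt) _,
      indicator_of_notMem (fun ht => absurd ht.2 h.not_gt) _⟩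

lemma max_half_sub_eq {t : ℝ} (ht : t ∈ Icc (0 : ℝ) 1) : max (1 / 2 - t) 0 = earlyAtHalf t := by
  rcases lt_or_ge t (1 / 2) with h | h
  · rw [earlyAtHalf, indicator_of_mem (show t ∈ Ico 0 (1 / 2) from ⟨ht.1, h⟩),
      max_eq_left (by linarith)]
  · rw [earlyAtHalf, indicator_of_notMem fun ht => absurd ht.2 h.not_gt,
      max_eq_right (by linarith)]

lemma max_one_sub_eq {t : ℝ} (ht : t ∈ Icc (0 : ℝ) 1) :
    max (1 - t) 0 = earlyAtOne t + lateAtOne t := by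
  rw [max_eq_left (by linarith [ht.2]), earlyAtOne, lateAtOne]
  rcases lt_or_ge t (1 / 2) with h | h
  · rw [indicator_of_mem (show t ∈ Ico 0 (1 / 2) from ⟨ht.1, h⟩),
      indicator_of_notMem fun ht => absurd ht.1 h.not_ge, add_zero]
  · rw [indicator_of_notMem fun ht => absurd ht.2 h.not_gt, zero_add]
    rcases ht.2.lt_or_eq with h' | rfl
    · rw [indicator_of_mem (show t ∈ Ico (1 / 2) 1 from ⟨h, h'⟩)]
    · simp

lemma liYorkeChaotic_rnnStep {k : ℕ} {a b : Fin k → ℝ} (hb : ∀ i, b i ∈ Icc (0 : ℝ) 1)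
    (h1 : 1 ≤ ∑ i, a i * earlyAtHalf (b i))
    (h2 : ∑ i, a i * (earlyAtOne (b i) + lateAtOne (b i)) ≤ 0) :
    LiYorkeChaotic (rnnStep a b) := by
  refine LiYorkeChaotic.of_continuous (continuous_rnnStep a b) (fun x _ => clip_mem_Icc _) ?_ ?_ ?_
  · have : ∀ i, max (0 - b i) 0 = 0 := fun i => max_eq_right (by linarith [(hb i).1])
    simp only [rnnStep, this, clip]
    simp
  · simp only [rnnStep, max_half_sub_eq (hb _), clip]
    rw [max_eq_left (by linarith), min_eq_right h1]
  · simp only [rnnStep, max_one_sub_eq (hb _), clip]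
    rw [max_eq_right h2, min_eq_left zero_le_one]

lemma integral_indicator_sub_sq_pos {l r y : ℝ} (hl : 0 ≤ l) (hlr : l < r) (hr : r ≤ y)
    (hy : y ≤ 1) :
    0 < ∫ t in Icc (0 : ℝ) 1, ((Ico l r).indicator (fun t => y - t) t) ^ 2 := by
  have hm : Measurable fun t => ((Ico l r).indicator (fun t => y - t) t) ^ 2 :=
    (Measurable.indicator (by fun_prop) measurableSet_Ico).pow_const 2
  have hI := fun t => sq_mem_Icc (indicator_sub_mem_Icc hl hr hy t)
  have hint : IntegrableOn (fun t => ((Ico l r).indicator (fun t => y - t) t) ^ 2) (Icc 0 1) :=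
    Integrable.of_bound hm.aestronglyMeasurable 1 (ae_of_all _ fun t => by
      rw [Real.norm_eq_abs, abs_of_nonneg (hI t).1]
      exact (hI t).2)
  rw [integral_pos_iff_support_of_nonneg (fun t => (hI t).1) hint]
  have hsub : Ico l r ⊆
      Function.support fun t => ((Ico l r).indicator (fun t => y - t) t) ^ 2 := fun t ht => by
    rw [Function.mem_support, indicator_of_mem ht]
    exact pow_ne_zero 2 (by linarith [ht.2])
  refine lt_of_lt_of_le ?_ (measure_mono hsub)
  rw [Measure.restrict_apply measurableSet_Ico, inter_eq_left.2, Real.volume_Ico]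
  · simpa using hlr
  · exact fun t ht => ⟨hl.trans ht.1, by linarith [ht.2]⟩

instance : IsProbabilityMeasure (volume.restrict (Icc (0 : ℝ) 1)) := ⟨by simp⟩

/-- For large `k`, with probability at least `1/2` all the biases lie in `[0,1]` and the empirical
means of `h₁` and `h₂` are at least half of the true means. -/
lemma exists_half_le_pi_bias {h₁ h₂ : ℝ → ℝ} (hm₁ : Measurable h₁) (hm₂ : Measurable h₂)
    (hI₁ : ∀ x, h₁ x ∈ Icc (0 : ℝ) 1) (hI₂ : ∀ x, h₂ x ∈ Icc (0 : ℝ) 1)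
    (hpos₁ : 0 < ∫ x in Icc (0 : ℝ) 1, h₁ x) (hpos₂ : 0 < ∫ x in Icc (0 : ℝ) 1, h₂ x) :
    ∃ K : ℕ, 0 < K ∧ ∀ k ≥ K,
      1 / 2 ≤ (Measure.pi fun _ : Fin k => volume.restrict (Icc (0 : ℝ) 1)).real
        {b | (∀ i, b i ∈ Icc (0 : ℝ) 1) ∧
          k * ((∫ x in Icc (0 : ℝ) 1, h₁ x) / 2) ≤ ∑ i, h₁ (b i) ∧
          k * ((∫ x in Icc (0 : ℝ) 1, h₂ x) / 2) ≤ ∑ i, h₂ (b i)} := by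
  set m₁ := ∫ x in Icc (0 : ℝ) 1, h₁ x
  set m₂ := ∫ x in Icc (0 : ℝ) 1, h₂ x
  obtain ⟨K, hK⟩ := exists_nat_ge (max (4 / m₁ ^ 2) (4 / m₂ ^ 2))
  refine ⟨K + 1, K.succ_pos, fun k hk => ?_⟩
  have : Nonempty (Fin k) := ⟨⟨0, by omega⟩⟩
  have hkK : (K : ℝ) ≤ k := by exact_mod_cast (by omega : K ≤ k)
  have hk0 : (0 : ℝ) < k := by exact_mod_cast (by omega : 0 < k)
  have hbound : ∀ m : ℝ, 0 < m → 4 / m ^ 2 ≤ k → 1 / ((k : ℝ) * m ^ 2) ≤ 1 / 4 := fun m hm h => by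
    rw [div_le_iff₀ (by positivity)] at h
    exact one_div_le_one_div_of_le (by norm_num) h
  have hB₁ := hbound m₁ hpos₁ ((le_max_left _ _).trans (hK.trans hkK))
  have hB₂ := hbound m₂ hpos₂ ((le_max_right _ _).trans (hK.trans hkK))
  set π := Measure.pi fun _ : Fin k => volume.restrict (Icc (0 : ℝ) 1)
  have hP₁ := pi_real_sum_lt_le (ι := Fin k) _ hm₁ hI₁ hpos₁
  have hP₂ := pi_real_sum_lt_le (ι := Fin k) _ hm₂ hI₂ hpos₂
  rw [Fintype.card_fin] at hP₁ hP₂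
  have hcube : π.real (univ.pi fun _ => Icc (0 : ℝ) 1) = 1 := by
    rw [Measure.real, Measure.pi_pi]
    simp
  have hsub : (univ.pi fun _ => Icc (0 : ℝ) 1) ⊆
      {b : Fin k → ℝ | (∀ i, b i ∈ Icc (0 : ℝ) 1) ∧
        k * (m₁ / 2) ≤ ∑ i, h₁ (b i) ∧ k * (m₂ / 2) ≤ ∑ i, h₂ (b i)} ∪
      ({b | ∑ i, h₁ (b i) < k * (m₁ / 2)} ∪ {b | ∑ i, h₂ (b i) < k * (m₂ / 2)}) := by
    intro b hb
    rcases lt_or_ge (∑ i, h₁ (b i)) (k * (m₁ / 2)) with h | h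
    · exact Or.inr (Or.inl h)
    rcases lt_or_ge (∑ i, h₂ (b i)) (k * (m₂ / 2)) with h' | h'
    · exact Or.inr (Or.inr h')
    exact Or.inl ⟨fun i => hb i (mem_univ i), h, h'⟩
  have hu₁ := (measureReal_mono hsub (μ := π)).trans (measureReal_union_le _ _)
  have hu₂ := measureReal_union_le (μ := π) {b | ∑ i, h₁ (b i) < k * (m₁ / 2)}
    {b | ∑ i, h₂ (b i) < k * (m₂ / 2)}
  linarith

/-- **Li-Yorke Chaos at Initialization.** Under He normal initialization
(weights i.i.d. `N(0, 2/k)`, biases i.i.d. `Uniform[0,1]`), for all sufficiently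
large widths `k`, the RNN step map is Li-Yorke chaotic with probability at least
some constant `δ > 0` independent of the width. -/
theorem liYorke_chaos_at_He_initialization :
    ∃ δ : ℝ, 0 < δ ∧ ∃ K : ℕ, ∀ k : ℕ, K ≤ k →
      ENNReal.ofReal δ ≤
        rnnMeasure k (2 / k) {p | LiYorkeChaotic (rnnStep p.1 p.2)} := by
  have hpos₁ : 0 < ∫ t in Icc (0 : ℝ) 1, earlyAtHalf t ^ 2 :=
    integral_indicator_sub_sq_pos le_rfl (by norm_num) le_rfl (by norm_num)
  have hpos₂ : 0 < ∫ t in Icc (0 : ℝ) 1, lateAtOne t ^ 2 :=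
    integral_indicator_sub_sq_pos (by norm_num) (by norm_num) le_rfl le_rfl
  obtain ⟨K, hK0, hK⟩ := exists_half_le_pi_bias (measurable_earlyAtHalf.pow_const 2)
    (measurable_lateAtOne.pow_const 2) (fun t => sq_mem_Icc (earlyAtHalf_mem_Icc t))
    (fun t => sq_mem_Icc (lateAtOne_mem_Icc t)) hpos₁ hpos₂
  set m₁ := ∫ t in Icc (0 : ℝ) 1, earlyAtHalf t ^ 2
  set m₂ := ∫ t in Icc (0 : ℝ) 1, lateAtOne t ^ 2
  obtain ⟨δ, hδ, hgauss⟩ := exists_le_pi_gaussianReal (lt_min hpos₁ hpos₂) 2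
  refine ⟨δ * (1 / 2), by positivity, K, fun k hk => ?_⟩
  have hk0 : (0 : ℝ) < k := by exact_mod_cast hK0.trans_le hk
  specialize hK k hk
  set G := {b : Fin k → ℝ | (∀ i, b i ∈ Icc (0 : ℝ) 1) ∧
    k * (m₁ / 2) ≤ ∑ i, earlyAtHalf (b i) ^ 2 ∧ k * (m₂ / 2) ≤ ∑ i, lateAtOne (b i) ^ 2}
  set F := {p : (Fin k → ℝ) × (Fin k → ℝ) | 1 ≤ ∑ i, p.1 i * earlyAtHalf (p.2 i) ∧
    ∑ i, p.1 i * (earlyAtOne (p.2 i) + lateAtOne (p.2 i)) ≤ 0}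
  have hG : MeasurableSet G := by
    simp only [G, ofPred_and, ofPred_forall]
    exact (MeasurableSet.iInter fun i => measurableSet_Icc.preimage (measurable_pi_apply i)).inter
      ((measurableSet_le measurable_const (by fun_prop)).inter
        (measurableSet_le measurable_const (by fun_prop)))
  have hF : MeasurableSet F := by
    simp only [F, ofPred_and]
    exact (measurableSet_le measurable_const (by fun_prop)).inter
      (measurableSet_le (by fun_prop) measurable_const)
  have hscale : ∀ m S : ℝ, k * (m / 2) ≤ S → m ≤ (2 / k : ℝ≥0) * S := fun m S h => by
    push_cast
    rw [div_mul_eq_mul_div, le_div_iff₀ hk0]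
    linarith
  have hslice : ∀ b ∈ G, ENNReal.ofReal δ ≤
      (Measure.pi fun _ : Fin k => gaussianReal 0 (2 / k)) ((fun a => (a, b)) ⁻¹' F) := by
    rintro b ⟨-, hb₁, hb₂⟩
    refine ENNReal.ofReal_le_of_le_toReal (hgauss (2 / k) (fun i => earlyAtHalf (b i))
      (fun i => earlyAtOne (b i)) (fun i => lateAtOne (b i)) (fun i => lateAtOne_eq_zero_or _)
      ((min_le_left _ _).trans (hscale _ _ hb₁)) ?_ ((min_le_right _ _).trans (hscale _ _ hb₂)))
    have hsum : ∑ i, earlyAtOne (b i) ^ 2 ≤ k := by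
      simpa using Finset.sum_le_card_nsmul Finset.univ _ 1
        fun i _ => (sq_mem_Icc (earlyAtOne_mem_Icc (b i))).2
    push_cast
    rw [div_mul_eq_mul_div, div_le_iff₀ hk0]
    linarith
  have hsub : F ∩ Prod.snd ⁻¹' G ⊆ {p | LiYorkeChaotic (rnnStep p.1 p.2)} :=
    fun p hp => liYorkeChaotic_rnnStep hp.2.1 hp.1.1 hp.1.2
  refine le_trans ?_ (measure_mono hsub)
  rw [rnnMeasure, Measure.prod_apply_symm (hF.inter (hG.preimage measurable_snd))]
  calc ENNReal.ofReal (δ * (1 / 2))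
      ≤ ENNReal.ofReal δ * (Measure.pi fun _ : Fin k => volume.restrict (Icc (0 : ℝ) 1)) G := by
        rw [ENNReal.ofReal_mul hδ.le]
        gcongr
        exact ENNReal.ofReal_le_of_le_toReal hK
    _ = ∫⁻ _ in G, ENNReal.ofReal δ ∂(Measure.pi fun _ : Fin k =>
        volume.restrict (Icc (0 : ℝ) 1)) := by rw [setLIntegral_const]
    _ ≤ ∫⁻ b in G, (Measure.pi fun _ : Fin k => gaussianReal 0 (2 / k))
        ((fun a => (a, b)) ⁻¹' (F ∩ Prod.snd ⁻¹' G)) ∂(Measure.pi fun _ : Fin k =>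
        volume.restrict (Icc (0 : ℝ) 1)) :=
      setLIntegral_mono' hG fun b hb =>
        (hslice b hb).trans (measure_mono fun a ha => ⟨ha, hb⟩)
    _ ≤ _ := setLIntegral_le_lintegral _ _
end

section
/- For every δ ∈ (0, 1) there exist σ > 0 and K ∈ ℕ such that for all k ≥ K, if the weights a_1, …, a_k are i.i.d. Gaussian N(0, σ²/k) and the biases b_1, …, b_k are i.i.d. Uniform[0,1] independent of the weights, then the probability that the RNN step map f_{a,b} has a point of period 3 is at least 1 − δ. -/
open MeasureTheory ProbabilityTheory Filter Set
open scoped NNReal ENNReal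

/-- `f` has a point of period 3 in `[0,1]`. -/
def HasPeriod3 (f : ℝ → ℝ) : Prop :=
  ∃ x ∈ Set.Icc (0:ℝ) 1, f (f (f x)) = x ∧ f x ≠ x

lemma gaussianReal_Ici_ge {w : ℝ≥0} {s : ℝ} (hs : 0 ≤ s) (h : s ^ 2 ≤ w) :
    (gaussianReal 0 1).real (Ici 1) ≤ (gaussianReal 0 w).real (Ici s) := by
  have hmap : (gaussianReal 0 1).map (√w * ·) = gaussianReal 0 w := by
    rw [gaussianReal_map_const_mul]
    congr 1
    · simp
    · ext; simp
  rw [← hmap, map_measureReal_apply (by fun_prop) measurableSet_Ici]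
  refine measureReal_mono fun x hx => ?_
  have hsw : s ≤ √w := Real.le_sqrt_of_sq_le h
  have hx1 : (1 : ℝ) ≤ x := hx
  simp only [mem_preimage, mem_Ici]
  nlinarith

lemma gaussianReal_Iic_neg (w : ℝ≥0) (s : ℝ) :
    (gaussianReal 0 w).real (Iic (-s)) = (gaussianReal 0 w).real (Ici s) := by
  have hmap := gaussianReal_map_neg (μ := 0) (v := w)
  rw [neg_zero] at hmap
  nth_rw 1 [← hmap]
  rw [map_measureReal_apply (by fun_prop) measurableSet_Iic]
  congr 1
  ext x
  simp

lemma gaussianReal_Ici_one_pos : 0 < (gaussianReal 0 1).real (Ici 1) := by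
  refine ENNReal.toReal_pos (fun h => ?_) (measure_ne_top _ _)
  have := gaussianReal_absolutelyContinuous' 0 one_ne_zero h
  simp at this

section LinearForms

variable {ι : Type*} [Fintype ι] {v : ℝ≥0}

lemma memLp_eval_pi_gaussianReal (i : ι) :
    MemLp (fun a : ι → ℝ => a i) 2 (Measure.pi fun _ => gaussianReal 0 v) :=
  (memLp_id_gaussianReal 2).comp_measurePreserving (measurePreserving_eval _ i)

lemma integral_linear_pi_gaussianReal (c : ι → ℝ) :
    ∫ a, ∑ i, a i * c i ∂(Measure.pi fun _ : ι => gaussianReal 0 v) = 0 := by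
  rw [integral_finsetSum _ fun i _ =>
    ((memLp_eval_pi_gaussianReal i).integrable one_le_two).mul_const _]
  refine Finset.sum_eq_zero fun i _ => ?_
  have h := integral_comp_eval (μ := fun _ : ι => gaussianReal 0 v) (i := i) (f := fun x : ℝ => x)
    (by fun_prop)
  rw [integral_mul_const, h]
  simp

lemma covariance_linear_pi_gaussianReal (c d : ι → ℝ) :
    cov[fun a => ∑ i, a i * c i, fun a => ∑ i, a i * d i;
      Measure.pi fun _ : ι => gaussianReal 0 v] = v * ∑ i, c i * d i := by
  classical
  have hind : iIndepFun (fun i (a : ι → ℝ) => a i) (Measure.pi fun _ => gaussianReal 0 v) :=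
    iIndepFun_pi (X := fun _ => id) fun _ => aemeasurable_id
  rw [covariance_fun_sum_fun_sum
    (fun i => (memLp_eval_pi_gaussianReal i).mul_const (c i))
    (fun i => (memLp_eval_pi_gaussianReal i).mul_const (d i)), Finset.mul_sum]
  refine Finset.sum_congr rfl fun i _ => ?_
  simp_rw [covariance_mul_const_left, covariance_mul_const_right]
  rw [Finset.sum_eq_single i]
  · rw [covariance_self (measurable_pi_apply i).aemeasurable]
    have : Var[fun a : ι → ℝ => a i; Measure.pi fun _ => gaussianReal 0 v] = v := by
      have h := (measurePreserving_eval (fun _ : ι => gaussianReal 0 v) i)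
      have h2 := variance_map (μ := Measure.pi fun _ : ι => gaussianReal 0 v) (X := id)
        (Y := Function.eval i) aemeasurable_id (measurable_pi_apply i).aemeasurable
      rw [h.map_eq, variance_id_gaussianReal] at h2
      exact h2.symm
    rw [this]; ring
  · intro j _ hji
    rw [(hind.indepFun hji.symm).covariance_eq_zero (memLp_eval_pi_gaussianReal i)
      (memLp_eval_pi_gaussianReal j)]
    simp
  · simp

lemma variance_linear_pi_gaussianReal (c : ι → ℝ) :
    Var[fun a => ∑ i, a i * c i; Measure.pi fun _ : ι => gaussianReal 0 v]
      = v * ∑ i, c i ^ 2 := by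
  rw [← covariance_self (Measurable.aemeasurable (by fun_prop)), covariance_linear_pi_gaussianReal]
  simp_rw [sq]

lemma hasGaussianLaw_id_pi_gaussianReal :
    HasGaussianLaw (fun a : ι → ℝ => a) (Measure.pi fun _ => gaussianReal 0 v) := by
  refine iIndepFun.hasGaussianLaw (X := fun i (a : ι → ℝ) => a i) (fun i => ?_)
    (iIndepFun_pi (X := fun _ => id) fun _ => aemeasurable_id)
  refine HasLaw.hasGaussianLaw (μ := gaussianReal 0 v) ⟨(measurable_pi_apply i).aemeasurable, ?_⟩
  exact (measurePreserving_eval (fun _ : ι => gaussianReal 0 v) i).map_eq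

lemma map_linear_pi_gaussianReal (c : ι → ℝ) :
    (Measure.pi fun _ : ι => gaussianReal 0 v).map (fun a => ∑ i, a i * c i)
      = gaussianReal 0 (v * ∑ i, c i ^ 2).toNNReal := by
  have h : HasGaussianLaw (fun a : ι → ℝ => ∑ i, a i * c i)
      (Measure.pi fun _ => gaussianReal 0 v) :=
    (hasGaussianLaw_id_pi_gaussianReal.map_fun
      (∑ i, (ContinuousLinearMap.proj (R := ℝ) (φ := fun _ : ι => ℝ) i).smulRight (c i))).congr
      (.of_forall fun a => by simp)
  rw [h.map_eq_gaussianReal, integral_linear_pi_gaussianReal, variance_linear_pi_gaussianReal]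

lemma measureReal_linear_ge {c : ι → ℝ} {s : ℝ} (hs : 0 ≤ s) (h : s ^ 2 ≤ v * ∑ i, c i ^ 2) :
    (gaussianReal 0 1).real (Ici 1) ≤
      (Measure.pi fun _ : ι => gaussianReal 0 v).real {a | s ≤ ∑ i, a i * c i} := by
  have := gaussianReal_Ici_ge hs (w := (v * ∑ i, c i ^ 2).toNNReal)
    (h.trans (Real.le_coe_toNNReal _))
  rwa [← map_linear_pi_gaussianReal, map_measureReal_apply (by fun_prop) measurableSet_Ici] at this

lemma measureReal_linear_le_neg {c : ι → ℝ} {s : ℝ} (hs : 0 ≤ s)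
    (h : s ^ 2 ≤ v * ∑ i, c i ^ 2) :
    (gaussianReal 0 1).real (Ici 1) ≤
      (Measure.pi fun _ : ι => gaussianReal 0 v).real {a | ∑ i, a i * c i ≤ -s} := by
  have := gaussianReal_Ici_ge hs (w := (v * ∑ i, c i ^ 2).toNNReal)
    (h.trans (Real.le_coe_toNNReal _))
  rwa [← gaussianReal_Iic_neg _ s, ← map_linear_pi_gaussianReal,
    map_measureReal_apply (by fun_prop) measurableSet_Iic] at this

lemma measureReal_abs_linear_ge (c : ι → ℝ) {M : ℝ} (hM : 0 < M) :
    (Measure.pi fun _ : ι => gaussianReal 0 v).real {a | M ≤ |∑ i, a i * c i|} ≤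
      (v * ∑ i, c i ^ 2) / M ^ 2 := by
  have hmem : MemLp (fun a : ι → ℝ => ∑ i, a i * c i) 2 (Measure.pi fun _ => gaussianReal 0 v) :=
    memLp_finsetSum _ fun i _ => (memLp_eval_pi_gaussianReal i).mul_const (c i)
  have := meas_ge_le_variance_div_sq hmem hM
  simp only [integral_linear_pi_gaussianReal, sub_zero, variance_linear_pi_gaussianReal] at this
  exact ENNReal.toReal_le_of_le_ofReal (by positivity) this

/-- Among `n` pairs of mutually orthogonal linear forms in i.i.d. Gaussian variables, with
probability exponentially close to one some pair takes a large negative value on its first form and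
a large positive value on its second one. -/
lemma measureReal_no_pair_le {n : ℕ} (c : Fin n → Bool → ι → ℝ) (s : Fin n → Bool → ℝ)
    (hs : ∀ m e, 0 ≤ s m e) (hvar : ∀ m e, s m e ^ 2 ≤ v * ∑ i, c m e i ^ 2)
    (hpair : ∀ m, ∑ i, c m false i * c m true i = 0)
    (horth : ∀ m m', m ≠ m' → ∀ e e', ∑ i, c m e i * c m' e' i = 0) :
    (Measure.pi fun _ : ι => gaussianReal 0 v).real
      {a | ∀ m, ¬ (∑ i, a i * c m false i ≤ -s m false ∧ s m true ≤ ∑ i, a i * c m true i)} ≤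
      (1 - (gaussianReal 0 1).real (Ici 1) ^ 2) ^ n := by
  set P := Measure.pi fun _ : ι => gaussianReal 0 v with hP
  set p := (gaussianReal 0 1).real (Ici 1) with hp
  let X : Fin n → Bool → (ι → ℝ) → ℝ := fun m e a => ∑ i, a i * c m e i
  have hX : HasGaussianLaw (fun a m e => X m e a) P :=
    (hasGaussianLaw_id_pi_gaussianReal.map_fun
      (ContinuousLinearMap.pi fun m => ContinuousLinearMap.pi fun e =>
        ∑ i, (ContinuousLinearMap.proj (R := ℝ) (φ := fun _ : ι => ℝ) i).smulRight
          (c m e i))).congr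
      (.of_forall fun a => by ext m e; simp [X])
  have hind : iIndepFun (fun m a e => X m e a) P :=
    hX.iIndepFun_of_covariance_eval fun m m' hm e e' => by
      simp only [X, hP]
      rw [covariance_linear_pi_gaussianReal, horth m m' hm, mul_zero]
  let B : Fin n → Set (Bool → ℝ) := fun m => {y | y false ≤ -s m false ∧ s m true ≤ y true}
  have hB : ∀ m, MeasurableSet (B m) := fun m =>
    (measurableSet_le (measurable_pi_apply false) measurable_const).inter
      (measurableSet_le measurable_const (measurable_pi_apply true))
  have hXm : ∀ m, Measurable (fun a e => X m e a) := fun m => by fun_prop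
  have hmul := hind.measure_inter_preimage_eq_mul Finset.univ (sets := fun m => (B m)ᶜ)
    (fun m _ => (hB m).compl)
  have hset : {a | ∀ m, ¬ (∑ i, a i * c m false i ≤ -s m false ∧
      s m true ≤ ∑ i, a i * c m true i)} =
      ⋂ m ∈ (Finset.univ : Finset (Fin n)), (fun a e => X m e a) ⁻¹' (B m)ᶜ := by
    ext a; simp [B, X]
  rw [hset, measureReal_def, hmul, ENNReal.toReal_prod]
  have hfac : ∀ m, P.real ((fun a e => X m e a) ⁻¹' (B m)ᶜ) ≤ 1 - p ^ 2 := by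
    intro m
    rw [preimage_compl, probReal_compl_eq_one_sub (hXm m (hB m))]
    have hpi : IndepFun (X m false) (X m true) P := by
      refine HasGaussianLaw.indepFun_of_covariance_eq_zero ((hX.eval m).prodMk false true) ?_
      simp only [X, hP]
      rw [covariance_linear_pi_gaussianReal, hpair, mul_zero]
    have h2 := hpi.measure_inter_preimage_eq_mul (Iic (-s m false)) (Ici (s m true))
      measurableSet_Iic measurableSet_Ici
    have h3 : (fun a e => X m e a) ⁻¹' (B m) =
      X m false ⁻¹' Iic (-s m false) ∩ X m true ⁻¹' Ici (s m true) := by ext; simp [B]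
    rw [h3, measureReal_def, h2, ENNReal.toReal_mul]
    have h4 : p ≤ (P (X m false ⁻¹' Iic (-s m false))).toReal :=
      measureReal_linear_le_neg (hs m false) (hvar m false)
    have h5 : p ≤ (P (X m true ⁻¹' Ici (s m true))).toReal :=
      measureReal_linear_ge (hs m true) (hvar m true)
    have hp0 : 0 ≤ p := measureReal_nonneg
    nlinarith [mul_le_mul h4 h5 hp0 (hp0.trans h4)]
  calc _ ≤ ∏ _m : Fin n, (1 - p ^ 2) :=
        Finset.prod_le_prod (fun _ _ => ENNReal.toReal_nonneg) fun m _ => hfac m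
    _ = _ := by simp

end LinearForms

theorem hasPeriod3_of_up_down {f : ℝ → ℝ} (hf : Continuous f) {q r : ℝ}
    (hq : 0 ≤ q) (hqr : q < r) (hr : r ≤ 1) (h0 : f 0 = 0) (hfq : f q = 1) (hfr : f r = 0) :
    HasPeriod3 f := by
  obtain ⟨z, hz, hfz⟩ : ∃ z ∈ Icc q r, f z - z = 0 := by
    have := intermediate_value_Icc' hqr.le (f := fun x => f x - x) (by fun_prop)
    exact this ⟨by simp only [hfr]; linarith, by simp only [hfq]; linarith⟩
  have hzq : q < z := by
    rcases hz.1.lt_or_eq with h | h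
    · exact h
    · subst h; linarith
  have hcomp : IsCompact (Icc 0 q ∩ f ⁻¹' Iic z) :=
    isCompact_Icc.inter_right (isClosed_Iic.preimage hf)
  obtain ⟨x₀, ⟨hx₀, hfx₀⟩, hmax⟩ := hcomp.exists_isGreatest
    ⟨0, ⟨le_rfl, hq⟩, by simp only [mem_preimage, mem_Iic, h0]; linarith⟩
  have hz1 : z ≤ 1 := hz.2.trans hr
  have hfx₀z : f x₀ = z := by
    obtain ⟨y, hy, hfy⟩ := intermediate_value_Icc hx₀.2 hf.continuousOn
      (show z ∈ Icc (f x₀) (f q) from ⟨hfx₀, by rw [hfq]; exact hz1⟩)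
    have : y ≤ x₀ := hmax ⟨⟨hx₀.1.trans hy.1, hy.2⟩, hfy.le⟩
    rwa [le_antisymm this hy.1] at hfy
  obtain ⟨x₁, hx₁, hfx₁⟩ := intermediate_value_Icc hx₀.2 hf.continuousOn
    (show r ∈ Icc (f x₀) (f q) from ⟨by rw [hfx₀z]; exact hz.2, by rw [hfq]; exact hr⟩)
  obtain ⟨x, hx, hfx⟩ : ∃ x ∈ Icc x₀ x₁, f (f (f x)) - x = 0 := by
    have hivt := intermediate_value_Icc' hx₁.1 (f := fun x => f (f (f x)) - x) (by fun_prop)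
    have hz' : f z = z := by linarith
    have hx₁0 := hx₀.1.trans hx₁.1
    have hx₀q := hx₀.2
    exact hivt ⟨by simp only [hfx₁, hfr, h0]; linarith, by simp only [hfx₀z, hz']; linarith⟩
  have hxq : x ≤ q := hx.2.trans hx₁.2
  refine ⟨x, ⟨hx₀.1.trans hx.1, by linarith⟩, by linarith, fun h => ?_⟩
  have : x ≤ x₀ := hmax ⟨⟨hx₀.1.trans hx.1, hxq⟩, by
    simp only [mem_preimage, mem_Iic, h]; linarith⟩
  rw [le_antisymm this hx.1, hfx₀z] at h
  linarith [hx₀.2]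

theorem hasPeriod3_rnnStep {k : ℕ} {a b : Fin k → ℝ} (hb : ∀ i, 0 ≤ b i) {q r : ℝ}
    (hq : 0 ≤ q) (hqr : q < r) (hr : r ≤ 1)
    (hgq : 1 ≤ ∑ i, a i * max (q - b i) 0) (hgr : ∑ i, a i * max (r - b i) 0 ≤ 0) :
    HasPeriod3 (rnnStep a b) := by
  refine hasPeriod3_of_up_down ?_ hq hqr hr ?_ ?_ ?_
  · unfold rnnStep clip; fun_prop
  · have : ∀ i, max (-b i) 0 = 0 := fun i => max_eq_right (by linarith [hb i])
    simp [rnnStep, clip, this]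
  · rw [rnnStep, clip, max_eq_left (by linarith), min_eq_right hgq]
  · rw [rnnStep, clip, max_eq_right hgr]; simp

instance isProbabilityMeasure_restrict_Icc_zero_one :
    IsProbabilityMeasure (volume.restrict (Icc (0 : ℝ) 1)) := ⟨by simp⟩

/-- The number of points of a finite family lying in `A`, as a real number. -/
noncomputable def countIn {k : ℕ} (A : Set ℝ) (b : Fin k → ℝ) : ℝ := ∑ i, A.indicator 1 (b i)

/-- Chebyshev's inequality for empirical frequencies. -/
lemma measureReal_countIn_deviation (μ : Measure ℝ) [IsProbabilityMeasure μ] {k : ℕ} (hk : 0 < k)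
    {A : Set ℝ} (hA : MeasurableSet A) {η : ℝ} (hη : 0 < η) :
    (Measure.pi fun _ : Fin k => μ).real {b | k * η ≤ |countIn A b - k * μ.real A|} ≤
      1 / (k * η ^ 2) := by
  have hk' : (0 : ℝ) < k := by exact_mod_cast hk
  have hmeas : Measurable (A.indicator (1 : ℝ → ℝ)) := measurable_one.indicator hA
  have hbound : ∀ x, A.indicator (1 : ℝ → ℝ) x ∈ Icc (0 : ℝ) 1 := fun x => by
    by_cases hx : x ∈ A <;> simp [hx]
  have hmem : MemLp (A.indicator (1 : ℝ → ℝ)) 2 μ :=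
    memLp_of_bounded (.of_forall hbound) hmeas.aestronglyMeasurable 2
  have hmem' : ∀ i, MemLp (fun b : Fin k → ℝ => A.indicator (1 : ℝ → ℝ) (b i)) 2
      (Measure.pi fun _ => μ) := fun i =>
    hmem.comp_measurePreserving (measurePreserving_eval _ i)
  have hint : ∫ b, countIn A b ∂(Measure.pi fun _ : Fin k => μ) = k * μ.real A := by
    unfold countIn
    rw [integral_finsetSum _ fun i _ => (hmem' i).integrable one_le_two]
    have : ∀ i : Fin k, ∫ b, A.indicator (1 : ℝ → ℝ) (b i) ∂(Measure.pi fun _ : Fin k => μ)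
        = μ.real A := fun i => by
      have h := integral_comp_eval (μ := fun _ : Fin k => μ) (i := i)
        (f := A.indicator (1 : ℝ → ℝ)) hmeas.aestronglyMeasurable
      rw [h, integral_indicator_one hA]
    simp [this]
  have hvar : Var[fun b => countIn A b; Measure.pi fun _ : Fin k => μ] ≤ k := by
    have h := variance_sum_pi (μ := fun _ : Fin k => μ) (X := fun _ => A.indicator (1 : ℝ → ℝ))
      fun _ => hmem
    have h1 : Var[A.indicator (1 : ℝ → ℝ); μ] ≤ 1 :=
      (variance_le_sq_of_bounded (.of_forall hbound) hmeas.aemeasurable).trans (by norm_num)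
    have h2 : (∑ i, fun b : Fin k → ℝ => A.indicator (1 : ℝ → ℝ) (b i)) =
        fun b => countIn A b := by
      ext b; simp [countIn]
    rw [h2] at h
    rw [h]
    simpa using mul_le_mul_of_nonneg_left h1 hk'.le
  have := meas_ge_le_variance_div_sq (X := fun b => countIn A b)
    (memLp_finsetSum _ fun i _ => hmem' i) (mul_pos hk' hη)
  rw [hint] at this
  refine (ENNReal.toReal_le_of_le_ofReal
    (div_nonneg (variance_nonneg _ _) (by positivity)) this).trans ?_
  calc _ ≤ (k : ℝ) / (k * η) ^ 2 := by gcongr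
    _ = _ := by field_simp

/-- The biases are well spread at the scales `r ^ (2 * j)` for `j < N`. -/
def WellSpread {k : ℕ} (r : ℝ) (N : ℕ) (b : Fin k → ℝ) : Prop :=
  (∀ i, 0 ≤ b i) ∧ ∀ j < N,
    countIn (Iic (r ^ (2 * (j + 1)))) b ≤ k * (2 * r ^ (2 * (j + 1))) ∧
    k * (r ^ (2 * j) / 8) ≤ countIn (Ioc (r ^ (2 * (j + 1))) (r ^ (2 * j) / 2)) b

lemma measureReal_not_wellSpread_le {k : ℕ} (hk : 0 < k) {r : ℝ} (hr : 0 < r) (hr4 : r ≤ 1 / 4)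
    (N : ℕ) :
    (Measure.pi fun _ : Fin k => volume.restrict (Icc (0 : ℝ) 1)).real
      {b | ¬ WellSpread r N b} ≤ N * (2 / (k * (r ^ (2 * N)) ^ 2)) := by
  set μ := volume.restrict (Icc (0 : ℝ) 1) with hμ
  set Q := Measure.pi fun _ : Fin k => μ with hQ
  set η := r ^ (2 * N) with hη
  have hη0 : 0 < η := by positivity
  have hk' : (0 : ℝ) < k := by exact_mod_cast hk
  let D : Set ℝ → Set (Fin k → ℝ) := fun A => {b | k * η ≤ |countIn A b - k * μ.real A|}
  have hneg : Q.real {b | ∃ i, b i < 0} = 0 := by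
    rw [measureReal_eq_zero_iff]
    have : {b : Fin k → ℝ | ∃ i, b i < 0} = ⋃ i, Function.eval i ⁻¹' Iio 0 := by ext; simp
    rw [this, measure_iUnion_null_iff]
    intro i
    rw [(measurePreserving_eval (fun _ : Fin k => μ) i).measure_preimage
      measurableSet_Iio.nullMeasurableSet, hμ, Measure.restrict_apply measurableSet_Iio]
    convert measure_empty (μ := volume)
    ext x
    simp only [mem_inter_iff, mem_Iio, mem_Icc, mem_empty_iff_false]
    exact iff_false_intro fun ⟨h, h', _⟩ => by linarith
  have hsub : {b | ¬ WellSpread r N b} ⊆ {b | ∃ i, b i < 0} ∪ ⋃ j ∈ Finset.range N,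
      (D (Iic (r ^ (2 * (j + 1)))) ∪ D (Ioc (r ^ (2 * (j + 1))) (r ^ (2 * j) / 2))) := by
    intro b hb
    by_contra hcon
    simp only [mem_union, mem_ofPred_eq, mem_iUnion, Finset.mem_range, not_or, not_exists,
      not_lt, not_le, D] at hcon
    refine hb ⟨hcon.1, fun j hj => ?_⟩
    obtain ⟨h1, h2⟩ := hcon.2 j hj
    have hle : η ≤ r ^ (2 * (j + 1)) :=
      pow_le_pow_of_le_one hr.le (by linarith) (by omega)
    have hstep : r ^ (2 * (j + 1)) ≤ r ^ (2 * j) / 16 := by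
      have : r ^ (2 * (j + 1)) = r ^ (2 * j) * r ^ 2 := by ring
      have hr2 : r ^ 2 ≤ 1 / 16 := by nlinarith
      have : 0 < r ^ (2 * j) := by positivity
      nlinarith
    have hu1 : r ^ (2 * j) ≤ 1 := pow_le_one₀ hr.le (by linarith)
    have hpos : 0 < r ^ (2 * (j + 1)) := by positivity
    have hm1 : μ.real (Iic (r ^ (2 * (j + 1)))) = r ^ (2 * (j + 1)) := by
      rw [hμ, measureReal_restrict_apply measurableSet_Iic]
      have : Iic (r ^ (2 * (j + 1))) ∩ Icc 0 1 = Icc 0 (r ^ (2 * (j + 1))) := by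
        ext x
        simp only [mem_inter_iff, mem_Iic, mem_Icc]
        exact ⟨fun h => ⟨h.2.1, h.1⟩, fun h => ⟨h.2, h.1, by linarith [h.2]⟩⟩
      rw [this, Real.volume_real_Icc_of_le hpos.le, sub_zero]
    have hm2 : μ.real (Ioc (r ^ (2 * (j + 1))) (r ^ (2 * j) / 2)) =
        r ^ (2 * j) / 2 - r ^ (2 * (j + 1)) := by
      rw [hμ, measureReal_restrict_apply measurableSet_Ioc, inter_eq_left.2,
        Real.volume_real_Ioc_of_le (by linarith)]
      intro x hx
      exact ⟨by linarith [hx.1], by linarith [hx.2]⟩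
    rw [hm1] at h1
    rw [hm2] at h2
    have h1' := (abs_lt.1 h1).2
    have h2' := (abs_lt.1 h2).1
    constructor
    · have := mul_le_mul_of_nonneg_left hle hk'.le
      linarith
    · have : k * (r ^ (2 * j) / 8) ≤
          k * (r ^ (2 * j) / 2 - r ^ (2 * (j + 1)) - η) :=
        mul_le_mul_of_nonneg_left (by linarith) hk'.le
      linarith
  calc Q.real {b | ¬ WellSpread r N b}
      ≤ _ := measureReal_mono hsub
    _ ≤ _ := measureReal_union_le _ _
    _ ≤ 0 + ∑ j ∈ Finset.range N, (1 / (k * η ^ 2) + 1 / (k * η ^ 2)) := by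
        refine add_le_add hneg.le ((measureReal_biUnion_finset_le _ _).trans ?_)
        refine Finset.sum_le_sum fun j _ => (measureReal_union_le _ _).trans ?_
        exact add_le_add (measureReal_countIn_deviation μ hk measurableSet_Iic hη0)
          (measureReal_countIn_deviation μ hk measurableSet_Ioc hη0)
    _ = _ := by simp; ring

/-- The value at `x` of the unclipped network. -/
noncomputable def preact {k : ℕ} (a b : Fin k → ℝ) (x : ℝ) : ℝ := ∑ i, a i * max (x - b i) 0

/-- The contribution to `max (r ^ (2 * j) - β) 0` of a bias `β` exceeding `r ^ (2 * (j + 1))`. -/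
noncomputable def freshCoeff (r : ℝ) (j : ℕ) (β : ℝ) : ℝ :=
  if r ^ (2 * (j + 1)) < β then max (r ^ (2 * j) - β) 0 else 0

/-- The contribution to `max (r ^ (2 * j) - β) 0` of a bias `β` at most `r ^ (2 * (j + 1))`. -/
noncomputable def pastCoeff (r : ℝ) (j : ℕ) (β : ℝ) : ℝ :=
  if r ^ (2 * (j + 1)) < β then 0 else max (r ^ (2 * j) - β) 0

lemma preact_eq_fresh_add_past {k : ℕ} (a b : Fin k → ℝ) (r : ℝ) (j : ℕ) :
    preact a b (r ^ (2 * j)) =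
      ∑ i, a i * freshCoeff r j (b i) + ∑ i, a i * pastCoeff r j (b i) := by
  rw [preact, ← Finset.sum_add_distrib]
  refine Finset.sum_congr rfl fun i _ => ?_
  unfold freshCoeff pastCoeff
  split_ifs <;> ring

lemma freshCoeff_mul_freshCoeff_of_lt {r : ℝ} (hr : 0 < r) (hr1 : r ≤ 1) {j j' : ℕ} (h : j < j')
    (β : ℝ) : freshCoeff r j β * freshCoeff r j' β = 0 := by
  by_cases hβ : r ^ (2 * (j + 1)) < β
  · have : r ^ (2 * j') ≤ r ^ (2 * (j + 1)) := pow_le_pow_of_le_one hr.le hr1 (by omega)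
    have h0 : max (r ^ (2 * j') - β) 0 = 0 := max_eq_right (by linarith)
    simp [freshCoeff, h0]
  · simp [freshCoeff, hβ]

lemma sum_freshCoeff_mul_freshCoeff {k : ℕ} (b : Fin k → ℝ) {r : ℝ} (hr : 0 < r) (hr1 : r ≤ 1)
    {j j' : ℕ} (h : j ≠ j') : ∑ i, freshCoeff r j (b i) * freshCoeff r j' (b i) = 0 := by
  refine Finset.sum_eq_zero fun i _ => ?_
  rcases h.lt_or_gt with h | h
  · exact freshCoeff_mul_freshCoeff_of_lt hr hr1 h _
  · rw [mul_comm]; exact freshCoeff_mul_freshCoeff_of_lt hr hr1 h _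

lemma le_sum_freshCoeff_sq {k : ℕ} (b : Fin k → ℝ) {r : ℝ} (hr : 0 < r) (j : ℕ) :
    (r ^ (2 * j) / 2) ^ 2 * countIn (Ioc (r ^ (2 * (j + 1))) (r ^ (2 * j) / 2)) b ≤
      ∑ i, freshCoeff r j (b i) ^ 2 := by
  rw [countIn, Finset.mul_sum]
  refine Finset.sum_le_sum fun i _ => ?_
  by_cases h : b i ∈ Ioc (r ^ (2 * (j + 1))) (r ^ (2 * j) / 2)
  · rw [indicator_of_mem h, freshCoeff, if_pos h.1]
    have : 0 < r ^ (2 * j) := by positivity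
    simp only [Pi.one_apply, mul_one]
    exact pow_le_pow_left₀ (by positivity) (le_max_of_le_left (by linarith [h.2])) 2
  · rw [indicator_of_notMem h, mul_zero]
    positivity

lemma sum_pastCoeff_sq_le {k : ℕ} {b : Fin k → ℝ} (hb : ∀ i, 0 ≤ b i) {r : ℝ} (hr : 0 < r)
    (j : ℕ) :
    ∑ i, pastCoeff r j (b i) ^ 2 ≤
      (r ^ (2 * j)) ^ 2 * countIn (Iic (r ^ (2 * (j + 1)))) b := by
  rw [countIn, Finset.mul_sum]
  refine Finset.sum_le_sum fun i _ => ?_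
  by_cases h : r ^ (2 * (j + 1)) < b i
  · rw [indicator_of_notMem (by simpa using h), pastCoeff, if_pos h]
    simp
  · rw [indicator_of_mem (by simpa using h), pastCoeff, if_neg h]
    have : 0 < r ^ (2 * j) := by positivity
    simp only [Pi.one_apply, mul_one]
    exact pow_le_pow_left₀ (le_max_right _ _) (max_le (by linarith [hb i]) this.le) 2

/-- Weights for which the network rises above `1` and then falls below `0` along one of the pairs
of scales. -/
def upDown {k : ℕ} (r : ℝ) (n : ℕ) (b : Fin k → ℝ) : Set (Fin k → ℝ) :=
  {a | ∃ m : Fin n, 1 ≤ preact a b (r ^ (2 * (2 * (m : ℕ) + 1))) ∧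
    preact a b (r ^ (2 * (2 * (m : ℕ)))) ≤ 0}

lemma measureReal_compl_upDown_le {k : ℕ} (hk : 0 < k) {r : ℝ} (hr : 0 < r) (hr1 : r ≤ 1)
    {n : ℕ} {b : Fin k → ℝ} (hb : WellSpread r (2 * n) b) {σ : ℝ} (hσ : 0 < σ)
    (hσr : 12 ≤ σ * r ^ (6 * n)) :
    (Measure.pi fun _ : Fin k => gaussianReal 0 (σ ^ 2 / k).toNNReal).real (upDown r n b)ᶜ ≤
      (1 - (gaussianReal 0 1).real (Ici 1) ^ 2) ^ n + 576 * n * r ^ 2 := by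
  have hk' : (0 : ℝ) < k := by exact_mod_cast hk
  set v := (σ ^ 2 / k).toNNReal with hv
  have hvk : (v : ℝ) = σ ^ 2 / k := Real.coe_toNNReal _ (by positivity)
  set P := Measure.pi fun _ : Fin k => gaussianReal 0 v with hP
  let J : Fin n → Bool → ℕ := fun m e => 2 * m + (if e then 1 else 0)
  have hJ : ∀ m e, J m e < 2 * n := fun m e => by
    have := m.2
    cases e <;> simp only [J] <;> grind
  let s : ℕ → ℝ := fun j => σ * r ^ (3 * j) / 6
  have hs0 : ∀ j, 0 < s j := fun j => by positivity
  have hs2 : ∀ j < 2 * n, 2 ≤ s j := fun j hj => by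
    have : r ^ (6 * n) ≤ r ^ (3 * j) := pow_le_pow_of_le_one hr.le hr1 (by omega)
    have := mul_le_mul_of_nonneg_left this hσ.le
    simp only [s]; linarith
  have hvar : ∀ j < 2 * n, s j ^ 2 ≤ v * ∑ i, freshCoeff r j (b i) ^ 2 := fun j hj => by
    calc s j ^ 2 ≤ v * ((r ^ (2 * j) / 2) ^ 2 * (k * (r ^ (2 * j) / 8))) := by
          have e1 : v * ((r ^ (2 * j) / 2) ^ 2 * (k * (r ^ (2 * j) / 8))) =
              σ ^ 2 * (r ^ (3 * j)) ^ 2 / 32 := by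
            rw [hvk]; field_simp; ring
          have e2 : s j ^ 2 = σ ^ 2 * (r ^ (3 * j)) ^ 2 / 36 := by simp only [s]; ring
          have : 0 ≤ σ ^ 2 * (r ^ (3 * j)) ^ 2 := by positivity
          rw [e1, e2]; linarith
      _ ≤ _ := by
          refine mul_le_mul_of_nonneg_left (le_trans ?_ (le_sum_freshCoeff_sq b hr j)) v.2
          exact mul_le_mul_of_nonneg_left (hb.2 j hj).2 (by positivity)
  have hpast : ∀ j < 2 * n, P.real {a | s j / 2 ≤ |∑ i, a i * pastCoeff r j (b i)|} ≤
      288 * r ^ 2 := fun j hj => by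
    refine (measureReal_abs_linear_ge _ (half_pos (hs0 j))).trans ?_
    rw [div_le_iff₀ (by have := hs0 j; positivity)]
    calc v * ∑ i, pastCoeff r j (b i) ^ 2
        ≤ v * ((r ^ (2 * j)) ^ 2 * (k * (2 * r ^ (2 * (j + 1))))) := by
          refine mul_le_mul_of_nonneg_left ((sum_pastCoeff_sq_le hb.1 hr j).trans ?_) v.2
          exact mul_le_mul_of_nonneg_left (hb.2 j hj).1 (by positivity)
      _ = 288 * r ^ 2 * (s j / 2) ^ 2 := by
          rw [hvk]; simp only [s]; field_simp; ring
      _ ≤ _ := le_rfl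
  have hfresh := measureReal_no_pair_le (v := v) (n := n)
    (fun m e i => freshCoeff r (J m e) (b i)) (fun m e => s (J m e)) (fun m e => (hs0 _).le)
    (fun m e => hvar _ (hJ m e))
    (fun m => sum_freshCoeff_mul_freshCoeff b hr hr1 (by simp [J]))
    (fun m m' hm e e' => sum_freshCoeff_mul_freshCoeff b hr hr1 (by
      have : (m : ℕ) ≠ m' := fun h => hm (Fin.ext h)
      cases e <;> cases e' <;> simp [J] <;> omega))
  have hsub : (upDown r n b)ᶜ ⊆
      {a | ∀ m : Fin n, ¬ (∑ i, a i * freshCoeff r (J m false) (b i) ≤ -s (J m false) ∧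
        s (J m true) ≤ ∑ i, a i * freshCoeff r (J m true) (b i))} ∪
      ⋃ j ∈ Finset.range (2 * n), {a | s j / 2 ≤ |∑ i, a i * pastCoeff r j (b i)|} := by
    intro a ha
    by_contra hcon
    simp only [mem_union, mem_ofPred_eq, mem_iUnion, Finset.mem_range, not_or, not_exists,
      not_forall, not_not, not_le] at hcon
    obtain ⟨⟨m, hm0, hm1⟩, hL⟩ := hcon
    refine ha ⟨m, ?_, ?_⟩
    · have h1 := abs_lt.1 (hL _ (hJ m true))
      have h2 := hs2 _ (hJ m true)
      have h3 := preact_eq_fresh_add_past a b r (J m true)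
      rw [show 2 * (m : ℕ) + 1 = J m true by simp [J], h3]
      linarith [h1.1]
    · have h1 := abs_lt.1 (hL _ (hJ m false))
      have h2 := hs2 _ (hJ m false)
      have h3 := preact_eq_fresh_add_past a b r (J m false)
      rw [show 2 * (m : ℕ) = J m false by simp [J], h3]
      linarith [h1.2]
  calc P.real (upDown r n b)ᶜ ≤ _ := measureReal_mono hsub
    _ ≤ _ := measureReal_union_le _ _
    _ ≤ (1 - (gaussianReal 0 1).real (Ici 1) ^ 2) ^ n +
          ∑ j ∈ Finset.range (2 * n), 288 * r ^ 2 := by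
        refine add_le_add hfresh ((measureReal_biUnion_finset_le _ _).trans ?_)
        exact Finset.sum_le_sum fun j hj => hpast j (Finset.mem_range.1 hj)
    _ = _ := by simp; ring

lemma hasPeriod3_of_mem_upDown {k : ℕ} {r : ℝ} (hr : 0 < r) (hr1 : r < 1) {n : ℕ}
    {a b : Fin k → ℝ} (hb : ∀ i, 0 ≤ b i) (ha : a ∈ upDown r n b) :
    HasPeriod3 (rnnStep a b) := by
  obtain ⟨m, h1, h2⟩ := ha
  exact hasPeriod3_rnnStep hb (by positivity)
    (pow_lt_pow_right_of_lt_one₀ hr hr1 (by omega)) (pow_le_one₀ hr.le hr1.le) h1 h2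

lemma measurableSet_upDown {k : ℕ} (r : ℝ) (n : ℕ) :
    MeasurableSet {p : (Fin k → ℝ) × (Fin k → ℝ) | (∀ i, 0 ≤ p.2 i) ∧ p.1 ∈ upDown r n p.2} := by
  simp only [upDown, preact, mem_ofPred_eq]
  measurability

/-- A union bound over a product measure: if for most `y` the section over `y` is large, then the
whole set is large. -/
lemma one_sub_le_measureReal_prod {α β : Type*} [MeasurableSpace α] [MeasurableSpace β]
    (P : Measure α) (Q : Measure β) [IsProbabilityMeasure P] [IsProbabilityMeasure Q]
    {S : Set (α × β)} (hS : MeasurableSet S) {G : Set β} {ε : ℝ} (hε : 0 ≤ ε)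
    (hG : ∀ y ∈ G, P.real {x | (x, y) ∉ S} ≤ ε) :
    1 - (ε + Q.real Gᶜ) ≤ (P.prod Q).real S := by
  have hle : (P.prod Q) Sᶜ ≤ ENNReal.ofReal ε + Q Gᶜ := by
    rw [Measure.prod_apply_symm hS.compl]
    calc ∫⁻ y, P ((fun x => (x, y)) ⁻¹' Sᶜ) ∂Q
        ≤ ∫⁻ y, (ENNReal.ofReal ε + Gᶜ.indicator (fun _ => 1) y) ∂Q := by
          refine lintegral_mono fun y => ?_
          by_cases hy : y ∈ G
          · refine le_add_right ?_
            rw [← ofReal_measureReal]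
            exact ENNReal.ofReal_le_ofReal (hG y hy)
          · refine le_add_left ?_
            rw [indicator_of_mem (by simpa using hy)]
            exact prob_le_one
      _ ≤ _ := by
          rw [lintegral_add_left measurable_const]
          simp only [lintegral_const, measure_univ, mul_one]
          gcongr
          exact (lintegral_indicator_const_le _ _).trans (by simp)
  have h := ENNReal.toReal_mono (by finiteness) hle
  rw [ENNReal.toReal_add (by finiteness) (by finiteness), ENNReal.toReal_ofReal hε] at h
  have h2 := probReal_compl_eq_one_sub (μ := P.prod Q) hS
  simp only [measureReal_def] at h2 ⊢
  linarith

/-- For every `δ ∈ (0,1)` there is a variance scale `σ` such that for all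
sufficiently large `k`, the RNN step map with weights i.i.d. `N(0, σ²/k)` and
biases i.i.d. `Uniform[0,1]` has a point of period 3 with probability at least
`1 - δ`. -/
theorem period_three_whp (δ : ℝ) (hδ0 : 0 < δ) (hδ1 : δ < 1) :
    ∃ σ : ℝ, 0 < σ ∧ ∃ K : ℕ, ∀ k : ℕ, K ≤ k →
      ENNReal.ofReal (1 - δ) ≤
        rnnMeasure k ((σ ^ 2 / k).toNNReal)
          {p | HasPeriod3 (rnnStep p.1 p.2)} := by
  set p := (gaussianReal 0 1).real (Ici 1) with hp
  have hp0 : 0 < p := gaussianReal_Ici_one_pos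
  have hp1 : p ≤ 1 := measureReal_le_one
  have hp2 : 0 < p ^ 2 := by positivity
  have hp3 : p ^ 2 ≤ 1 := pow_le_one₀ hp0.le hp1
  obtain ⟨n, hn⟩ := exists_pow_lt_of_lt_one (show 0 < δ / 4 by positivity)
    (show 1 - p ^ 2 < 1 by linarith)
  obtain ⟨r, hr, hr4, hrn⟩ : ∃ r : ℝ, 0 < r ∧ r ≤ 1 / 4 ∧ 576 * n * r ^ 2 ≤ δ / 4 := by
    refine ⟨min (1 / 4) (δ / (2304 * (n + 1))), by positivity, min_le_left _ _, ?_⟩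
    set r := min (1 / 4) (δ / (2304 * ((n : ℝ) + 1))) with hr
    have hr0 : 0 < r := by positivity
    have hr1 : r ≤ 1 / 4 := min_le_left _ _
    have hr2 : r * (2304 * (n + 1)) ≤ δ := (le_div_iff₀ (by positivity)).1 (min_le_right _ _)
    have hnr : 0 ≤ (n : ℝ) * r := by positivity
    nlinarith
  refine ⟨12 / r ^ (6 * n), by positivity, ⌈16 * n / (δ * (r ^ (2 * (2 * n))) ^ 2)⌉₊ + 1,
    fun k hK => ?_⟩
  have hk : 0 < k := by omega
  have hk' : (0 : ℝ) < k := by exact_mod_cast hk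
  have hkn : 16 * n / (δ * (r ^ (2 * (2 * n))) ^ 2) ≤ k :=
    (Nat.le_ceil _).trans (Nat.cast_le.2 (by omega))
  have hbias : (Measure.pi fun _ : Fin k => volume.restrict (Icc (0 : ℝ) 1)).real
      {b | ¬ WellSpread r (2 * n) b} ≤ δ / 4 := by
    refine (measureReal_not_wellSpread_le hk hr hr4 (2 * n)).trans ?_
    rw [div_le_iff₀ (by positivity)] at hkn
    rw [← mul_div_assoc, div_le_iff₀ (by positivity)]
    push_cast
    linarith
  have hmain := one_sub_le_measureReal_prod
    (Measure.pi fun _ : Fin k => gaussianReal 0 ((12 / r ^ (6 * n)) ^ 2 / k).toNNReal)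
    (Measure.pi fun _ : Fin k => volume.restrict (Icc (0 : ℝ) 1))
    (measurableSet_upDown r n) (G := {b | WellSpread r (2 * n) b}) (ε := δ / 4 + δ / 4)
    (by positivity) fun b hb => by
      refine le_trans (le_of_eq ?_) ((measureReal_compl_upDown_le hk hr (by linarith) hb
        (σ := 12 / r ^ (6 * n)) (by positivity) (by rw [div_mul_cancel₀ _ (by positivity)])).trans
        (add_le_add hn.le hrn))
      congr 1
      ext a
      simp [hb.1]
  have hle : ENNReal.ofReal (1 - δ) ≤ rnnMeasure k (((12 / r ^ (6 * n)) ^ 2 / k).toNNReal)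
      {p | (∀ i, 0 ≤ p.2 i) ∧ p.1 ∈ upDown r n p.2} := by
    refine ENNReal.ofReal_le_of_le_toReal (le_trans ?_ hmain)
    have : {b : Fin k → ℝ | WellSpread r (2 * n) b}ᶜ = {b | ¬ WellSpread r (2 * n) b} := rfl
    rw [this]
    linarith
  exact hle.trans (measure_mono fun p hp =>
    hasPeriod3_of_mem_upDown hr (by linarith) hp.1 hp.2)
end
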